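/- Let γ ∈ B_n be an element all of whose orbits are inversion-invariant, with k orbits of sizes 2n_1, …, 2n_k (n_1 + … + n_k = n), and let τ ∈ B_n with τ ≤ γ. Let Y_1, …, Y_m be the orbits of the subgroup of B_n generated by {τ, γ}, and for each j let γ_j denote the restriction of γ to Y_j. Then for every j, all orbits of γ_j are inversion-invariant and γ_j has at most 2 orbits. -/

import Mathlib

/-!  Common setup: annular non-crossing partitions of type B, following
Goulden–Nica–Oancea, "Enumerative properties of NC^(B)(p,q)". -/

/-- The underlying set `{±1, …, ±n}`, realized inside `ℤ`. -/
def signedSet (n : ℕ) : Set ℤ := {x : ℤ | x ≠ 0 ∧ |x| ≤ (n : ℤ)}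

/-- Membership in the hyperoctahedral group `B_n`, realized as the permutations of `ℤ`
that commute with negation and fix every point outside `{±1, …, ±n}`. -/
def inB (n : ℕ) (π : Equiv.Perm ℤ) : Prop :=
  (∀ x : ℤ, π (-x) = -(π x)) ∧ ∀ x : ℤ, x ∉ signedSet n → π x = x

/-- The set of generators of `B_n`:
`(i,j)(-i,-j)`, `(i,-j)(-i,j)` for `1 ≤ i ≠ j ≤ n`, and `(i,-i)` for `1 ≤ i ≤ n`. -/
def genB (n : ℕ) : Set (Equiv.Perm ℤ) :=
  {π | (∃ i j : ℤ, 1 ≤ i ∧ i ≤ (n : ℤ) ∧ 1 ≤ j ∧ j ≤ (n : ℤ) ∧ i ≠ j ∧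
          π = Equiv.swap i j * Equiv.swap (-i) (-j)) ∨
       (∃ i j : ℤ, 1 ≤ i ∧ i ≤ (n : ℤ) ∧ 1 ≤ j ∧ j ≤ (n : ℤ) ∧ i ≠ j ∧
          π = Equiv.swap i (-j) * Equiv.swap (-i) j) ∨
       (∃ i : ℤ, 1 ≤ i ∧ i ≤ (n : ℤ) ∧ π = Equiv.swap i (-i))}

/-- The length function `ℓ_B` on `B_n`: the least `k` such that `τ` is a product of `k`
generators from `genB n` (the empty product being the identity). -/
noncomputable def lenB (n : ℕ) (τ : Equiv.Perm ℤ) : ℕ :=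
  sInf {k : ℕ | ∃ l : List (Equiv.Perm ℤ),
    l.length = k ∧ (∀ g ∈ l, g ∈ genB n) ∧ l.prod = τ}

/-- The partial order on `B_n`:  `τ ≤ σ` iff `ℓ_B(σ) = ℓ_B(τ) + ℓ_B(τ⁻¹σ)`. -/
def leB (n : ℕ) (τ σ : Equiv.Perm ℤ) : Prop :=
  lenB n σ = lenB n τ + lenB n (τ⁻¹ * σ)

/-- The permutation `γ_{p,q} = (1,…,p,-1,…,-p)(p+1,…,p+q,-(p+1),…,-(p+q))`. -/
def gammaPQ (p q : ℕ) : Equiv.Perm ℤ :=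
  (((List.range p).map fun i => ((i : ℤ) + 1)) ++
      ((List.range p).map fun i => -((i : ℤ) + 1))).formPerm *
    (((List.range q).map fun i => ((p : ℤ) + (i : ℤ) + 1)) ++
      ((List.range q).map fun i => -((p : ℤ) + (i : ℤ) + 1))).formPerm

/-- The long cycle `γ_n = (1,…,n,-1,…,-n)` of `B_n` (disc case). -/
def gammaDisc (n : ℕ) : Equiv.Perm ℤ :=
  (((List.range n).map fun i => ((i : ℤ) + 1)) ++
    ((List.range n).map fun i => -((i : ℤ) + 1))).formPerm

/-- The annular non-crossing permutations of type B: `S^B_nc(p,q) = [ε, γ_{p,q}] ⊆ B_{p+q}`. -/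
def SncB (p q : ℕ) : Set (Equiv.Perm ℤ) :=
  {τ | inB (p + q) τ ∧ leB (p + q) τ (gammaPQ p q)}

/-- The orbit of `x` under the permutation `τ`. -/
def permOrbit (τ : Equiv.Perm ℤ) (x : ℤ) : Set ℤ := {y | ∃ m : ℤ, (τ ^ m) x = y}

/-- The partition `Ω(τ)` of `{±1,…,±n}` into orbits of `τ`. -/
def orbitsOn (n : ℕ) (τ : Equiv.Perm ℤ) : Set (Set ℤ) :=
  {A | ∃ x ∈ signedSet n, A = permOrbit τ x}

/-- The negation `-A` of a set `A ⊆ ℤ`. -/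
def negSet (A : Set ℤ) : Set ℤ := {x | -x ∈ A}

/-- The partition `Ω̃(τ)`, obtained from `Ω(τ)` by merging all inversion-invariant orbits
(orbits `A` with `A = -A`) into a single block. -/
def omegaTilde (n : ℕ) (τ : Equiv.Perm ℤ) : Set (Set ℤ) :=
  {A | A ∈ orbitsOn n τ ∧ negSet A ≠ A} ∪
    {B | B = ⋃₀ {A | A ∈ orbitsOn n τ ∧ negSet A = A} ∧ B.Nonempty}

/-- The annular non-crossing partitions of type B: `NC^B(p,q) = {Ω̃(τ) : τ ∈ S^B_nc(p,q)}`. -/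
def NCB (p q : ℕ) : Set (Set (Set ℤ)) :=
  {π | ∃ τ ∈ SncB p q, π = omegaTilde (p + q) τ}

/-- The type B non-crossing partitions of the disc: `NC^B(n) = {Ω̃(τ) : τ ∈ B_n, τ ≤ γ_n}`. -/
def NCBdisc (n : ℕ) : Set (Set (Set ℤ)) :=
  {π | ∃ τ, inB n τ ∧ leB n τ (gammaDisc n) ∧ π = omegaTilde n τ}

/-- Reverse refinement order on partitions: every block of `π` is contained in a block of `ρ`. -/
def refines (π ρ : Set (Set ℤ)) : Prop := ∀ A ∈ π, ∃ B ∈ ρ, A ⊆ B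

/-- The rank of a partition of `{±1,…,±n}`:
`n` minus half the number of blocks `A` with `A ≠ -A`. -/
noncomputable def rankNCB (n : ℕ) (π : Set (Set ℤ)) : ℕ :=
  n - {A | A ∈ π ∧ negSet A ≠ A}.ncard / 2

/-- The inner point set `{±(p+1), …, ±(p+q)}`. -/
def innerSet (p q : ℕ) : Set ℤ := {x : ℤ | (p : ℤ) < |x| ∧ |x| ≤ (p : ℤ) + (q : ℤ)}

/-- The connectivity of `π ∈ NC^B(p,q)`: half the number of blocks `A` with `A ≠ -A`
meeting both `{±1,…,±p}` and `{±(p+1),…,±(p+q)}`. -/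
noncomputable def connectivity (p q : ℕ) (π : Set (Set ℤ)) : ℕ :=
  {A | A ∈ π ∧ negSet A ≠ A ∧ (A ∩ signedSet p).Nonempty ∧
    (A ∩ innerSet p q).Nonempty}.ncard / 2

/-- The number of exterior pairs of blocks `{A, -A}` (with `A ≠ -A`, `A ⊆ {±1,…,±p}`). -/
noncomputable def extPairs (p : ℕ) (π : Set (Set ℤ)) : ℕ :=
  {A | A ∈ π ∧ negSet A ≠ A ∧ A ⊆ signedSet p}.ncard / 2

/-- The number of interior pairs of blocks `{A, -A}`
(with `A ≠ -A`, `A ⊆ {±(p+1),…,±(p+q)}`). -/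
noncomputable def intPairs (p q : ℕ) (π : Set (Set ℤ)) : ℕ :=
  {A | A ∈ π ∧ negSet A ≠ A ∧ A ⊆ innerSet p q}.ncard / 2

/-- The minimum `0̂` of `NC^B(p,q)` (with `n = p+q`): the partition into singletons. -/
def botNCB (n : ℕ) : Set (Set ℤ) := {A | ∃ x ∈ signedSet n, A = {x}}

/-- The maximum `1̂` of `NC^B(p,q)` (with `n = p+q`): the partition with a single block. -/
def topNCB (n : ℕ) : Set (Set ℤ) := {signedSet n}

/-- The orbit of `x` under the subgroup generated by `{τ, γ}`. -/
def jointOrbit (τ γ : Equiv.Perm ℤ) (x : ℤ) : Set ℤ :=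
  {y | ∃ g ∈ Subgroup.closure ({τ, γ} : Set (Equiv.Perm ℤ)), g x = y}

/-- The orbits on `{±1,…,±n}` of the subgroup generated by `{τ, γ}`. -/
def jointOrbitsOn (n : ℕ) (τ γ : Equiv.Perm ℤ) : Set (Set ℤ) :=
  {Y | ∃ x ∈ signedSet n, Y = jointOrbit τ γ x}

namespace NCBaux

open Classical

/-- product of swaps along a list of edges -/
noncomputable def sw (L : List (ℤ × ℤ)) : Equiv.Perm ℤ :=
  (L.map fun p => Equiv.swap p.1 p.2).prod

lemma sw_nil : sw [] = 1 := rfl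
lemma sw_cons (p : ℤ × ℤ) (L) : sw (p :: L) = Equiv.swap p.1 p.2 * sw L := by simp [sw]
lemma sw_append (L M) : sw (L ++ M) = sw L * sw M := by simp [sw]

lemma inv_swap {β : Type*} (h : ℤ → β) (a b x : ℤ) (H : h a = h b) :
    h (Equiv.swap a b x) = h x := by
  rw [Equiv.swap_apply_def]; split_ifs with h1 h2
  · rw [h1, H]
  · rw [h2, H]
  · rfl

lemma inv_sw {β : Type*} (h : ℤ → β) (L : List (ℤ × ℤ)) (H : ∀ p ∈ L, h p.1 = h p.2) (x : ℤ) :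
    h (sw L x) = h x := by
  induction L with
  | nil => simp [sw_nil]
  | cons p L ih =>
    rw [sw_cons, Equiv.Perm.mul_apply, inv_swap h _ _ _ (H p (by simp))]
    exact ih fun q hq => H q (by simp [hq])

lemma inv_closure {β : Type*} (h : ℤ → β) (T : Set (Equiv.Perm ℤ))
    (H : ∀ g ∈ T, ∀ x, h (g x) = h x) (g) (hg : g ∈ Subgroup.closure T) : ∀ x, h (g x) = h x := by
  induction hg using Subgroup.closure_induction with
  | mem g hg => exact H g hg
  | one => simp
  | mul a b _ _ ha hb => intro x; rw [Equiv.Perm.mul_apply, ha, hb]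
  | inv a _ ha => intro x; rw [← ha (a⁻¹ x)]; simp

lemma inv_zpow {β : Type*} (h : ℤ → β) (g : Equiv.Perm ℤ) (H : ∀ x, h (g x) = h x) (m : ℤ) (x : ℤ) :
    h ((g ^ m) x) = h x := by
  refine inv_closure h {g} (by simpa using H) _ ?_ x
  exact Subgroup.zpow_mem _ (Subgroup.subset_closure (Set.mem_singleton g)) m

lemma inv_orbit {β : Type*} (h : ℤ → β) (g : Equiv.Perm ℤ) (H : ∀ x, h (g x) = h x) {x y : ℤ}
    (hy : y ∈ permOrbit g x) : h y = h x := by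
  obtain ⟨m, rfl⟩ := hy
  exact inv_zpow h g H m x

lemma self_mem (g : Equiv.Perm ℤ) (x : ℤ) : x ∈ permOrbit g x := ⟨0, by simp⟩

lemma orbit_apply (g : Equiv.Perm ℤ) (x : ℤ) : permOrbit g (g x) = permOrbit g x := by
  ext y
  constructor
  · rintro ⟨m, rfl⟩; exact ⟨m + 1, by rw [zpow_add]; simp⟩
  · rintro ⟨m, rfl⟩; exact ⟨m - 1, by rw [zpow_sub]; simp⟩

lemma orbit_eq_of_mem {g : Equiv.Perm ℤ} {x y : ℤ} (h : y ∈ permOrbit g x) :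
    permOrbit g y = permOrbit g x := inv_orbit (permOrbit g) g (orbit_apply g) h

lemma orbit_refines {β : Type*} (h : ℤ → β) (g : Equiv.Perm ℤ) (H : ∀ x, h (g x) = h x) (x y : ℤ)
    (hxy : permOrbit g x = permOrbit g y) : h x = h y :=
  inv_orbit h g H (hxy ▸ self_mem g x)

lemma ncard_refine {β δ : Type*} (S : Set ℤ) (hS : S.Finite) (f : ℤ → β) (h : ℤ → δ)
    (H : ∀ x y, f x = f y → h x = h y) : (h '' S).ncard ≤ (f '' S).ncard := by
  have : h '' S = (fun b => h (Function.invFun f b)) '' (f '' S) := by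
    rw [Set.image_image]
    refine Set.image_congr fun x _ => ?_
    exact H _ _ (Function.invFun_eq ⟨x, rfl⟩).symm
  rw [this]
  exact Set.ncard_image_le (hS.image f)

/-- merge classes of a and b -/
noncomputable def mg {β : Type*} (f : ℤ → β) (a b : ℤ) : ℤ → β :=
  fun x => if f x = f b then f a else f x

lemma mg_self {β : Type*} (f : ℤ → β) (a b : ℤ) (h : f a = f b) : mg f a b = f := by
  funext x; unfold mg; split_ifs with h1
  · rw [h1, h]
  · rfl

lemma mg_ab {β : Type*} (f : ℤ → β) (a b : ℤ) : mg f a b a = mg f a b b := by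
  unfold mg; simp

lemma mg_ref {β : Type*} (f : ℤ → β) (a b : ℤ) {x y : ℤ} (h : f x = f y) :
    mg f a b x = mg f a b y := by
  unfold mg; rw [h]

lemma mg_min {β δ : Type*} (f : ℤ → β) (h : ℤ → δ) (a b : ℤ) (H : ∀ x y, f x = f y → h x = h y)
    (hab : h a = h b) (x y : ℤ) (hxy : mg f a b x = mg f a b y) : h x = h y := by
  unfold mg at hxy
  split_ifs at hxy with h1 h2 h2
  · exact (H _ _ h1).trans (H _ _ h2).symm
  · rw [H _ _ h1, ← hab]; exact H _ _ hxy
  · rw [H _ _ h2, ← hab]; exact H _ _ hxy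
  · exact H _ _ hxy

lemma mg_image {β : Type*} (f : ℤ → β) (a b : ℤ) (S : Set ℤ) (ha : a ∈ S)
    (h : f a ≠ f b) : mg f a b '' S = (f '' S) \ {f b} := by
  ext z
  constructor
  · rintro ⟨x, hx, rfl⟩
    unfold mg
    split_ifs with h1
    · exact ⟨⟨a, ha, rfl⟩, h⟩
    · exact ⟨⟨x, hx, rfl⟩, h1⟩
  · rintro ⟨⟨x, hx, rfl⟩, h1⟩
    refine ⟨x, hx, ?_⟩
    unfold mg
    exact if_neg h1

lemma mg_card {β : Type*} (f : ℤ → β) (a b : ℤ) (S : Set ℤ) (hS : S.Finite) (ha : a ∈ S) (hb : b ∈ S)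
    (h : f a ≠ f b) : (mg f a b '' S).ncard + 1 = (f '' S).ncard := by
  rw [mg_image f a b S ha h]
  exact Set.ncard_sdiff_singleton_add_one ⟨b, hb, rfl⟩ (hS.image f)

lemma mg_card_le {β : Type*} (f : ℤ → β) (a b : ℤ) (S : Set ℤ) (hS : S.Finite) (ha : a ∈ S)
    (hb : b ∈ S) : (f '' S).ncard ≤ (mg f a b '' S).ncard + 1 := by
  by_cases h : f a = f b
  · rw [mg_self f a b h]; omega
  · rw [mg_card f a b S hS ha hb h]

/-- component function of an edge list -/
noncomputable def comp : List (ℤ × ℤ) → ℤ → ℤ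
  | [] => id
  | p :: L => mg (comp L) p.1 p.2

lemma comp_edge (L : List (ℤ × ℤ)) : ∀ p ∈ L, comp L p.1 = comp L p.2 := by
  induction L with
  | nil => simp
  | cons q L ih =>
    intro p hp
    rcases List.mem_cons.1 hp with rfl | hp
    · exact mg_ab _ _ _
    · exact mg_ref _ _ _ (ih p hp)

lemma comp_mem (S : Set ℤ) (L : List (ℤ × ℤ)) (H : ∀ p ∈ L, (p.1 ∈ S ↔ p.2 ∈ S)) (x : ℤ) :
    comp L x ∈ S ↔ x ∈ S := by
  induction L generalizing x with
  | nil => simp [comp]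
  | cons q L ih =>
    have ih := ih fun p hp => H p (by simp [hp])
    have hq := H q (by simp)
    show mg (comp L) q.1 q.2 x ∈ S ↔ _
    unfold mg
    split_ifs with h
    · rw [ih, hq, ← ih q.2, ← h, ih]
    · exact ih x

lemma same_cycle (g : Equiv.Perm ℤ) (S : Set ℤ) (hS : S.Finite) (hg : ∀ x, g x ∈ S ↔ x ∈ S)
    (a b : ℤ) (ha : a ∈ S) (hab : permOrbit g a ≠ permOrbit g b) :
    permOrbit (Equiv.swap a b * g) a = permOrbit (Equiv.swap a b * g) b := by
  have hp : ∀ k : ℕ, (g ^ k) a ∈ S := by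
    intro k
    have := inv_zpow (fun x => x ∈ S) g (fun x => propext (hg x)) k a
    simpa [ha] using this
  have hex : ∃ k : ℕ, 0 < k ∧ (g ^ k) a = a := by
    obtain ⟨i, j, hij, h⟩ := Set.Finite.exists_lt_map_eq_of_forall_mem hp hS
    refine ⟨j - i, by omega, ?_⟩
    apply (g ^ i).injective
    rw [← Equiv.Perm.mul_apply, ← pow_add, show i + (j - i) = j by omega]
    exact h.symm
  have hk := Nat.find_spec hex
  have hmin := fun m => @Nat.find_min _ _ hex m
  set k := Nat.find hex
  have hi : ∀ i < k, ((Equiv.swap a b * g) ^ i) a = (g ^ i) a := by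
    intro i
    induction i with
    | zero => simp
    | succ i ih =>
      intro hlt
      rw [pow_succ', Equiv.Perm.mul_apply, ih (by omega), Equiv.Perm.mul_apply,
        ← Equiv.Perm.mul_apply g, ← pow_succ']
      apply Equiv.swap_apply_of_ne_of_ne
      · intro h; exact hmin _ hlt ⟨by omega, h⟩
      · intro h
        exact hab (orbit_eq_of_mem (y := b) ⟨((i+1 : ℕ) : ℤ), by rw [zpow_natCast]; exact h⟩).symm
  symm
  apply orbit_eq_of_mem
  refine ⟨(k : ℤ), ?_⟩
  obtain ⟨i, hik⟩ : ∃ i, k = i + 1 := ⟨k - 1, by omega⟩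
  rw [zpow_natCast, hik, pow_succ', Equiv.Perm.mul_apply, hi i (by omega), Equiv.Perm.mul_apply,
        ← Equiv.Perm.mul_apply g, ← pow_succ', ← hik, hk.2, Equiv.swap_apply_left]

lemma hurwitz (S : Set ℤ) (hS : S.Finite) (L : List (ℤ × ℤ))
    (H : ∀ p ∈ L, (p.1 ∈ S ↔ p.2 ∈ S)) :
    (permOrbit (sw L) '' S).ncard + S.ncard ≤
      (L.filter fun p => p.1 ∈ S).length + 2 * (comp L '' S).ncard := by
  induction L with
  | nil =>
    have := Set.ncard_image_le (f := permOrbit (sw [])) hS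
    simp [comp]; omega
  | cons q L ih =>
    obtain ⟨a, b⟩ := q
    have H' : ∀ p ∈ L, (p.1 ∈ S ↔ p.2 ∈ S) := fun p hp => H p (by simp [hp])
    have ih := ih H'
    have hq : a ∈ S ↔ b ∈ S := H (a, b) (by simp)
    have hgS : ∀ x, sw L x ∈ S ↔ x ∈ S := fun x =>
      iff_of_eq (inv_sw (fun x => x ∈ S) L (fun p hp => propext (H' p hp)) x)
    rw [sw_cons]
    have hc : comp ((a, b) :: L) = mg (comp L) a b := rfl
    rw [hc]
    change (permOrbit (Equiv.swap a b * sw L) '' S).ncard + _ ≤ _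
    set g := sw L with hgdef
    set g' := Equiv.swap a b * g with hg'
    by_cases ha : a ∈ S
    · have hb := hq.1 ha
      have hlen : (((a, b) :: L).filter fun p => p.1 ∈ S).length
          = (L.filter fun p => p.1 ∈ S).length + 1 := by simp [ha]
      rw [hlen]
      -- orbits of g refine merged orbits of g'
      have hgg : ∀ x, mg (permOrbit g') a b (g x) = mg (permOrbit g') a b x := by
        intro x
        rw [← inv_swap (mg (permOrbit g') a b) a b (g x) (mg_ab _ _ _)]
        exact mg_ref _ _ _ (orbit_apply g' x)
      have hR := orbit_refines (mg (permOrbit g') a b) g hgg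
      have h1 := ncard_refine S hS _ _ hR
      by_cases hab : comp L a = comp L b
      · have h2 := mg_card_le (permOrbit g') a b S hS ha hb
        rw [mg_self _ _ _ hab]
        omega
      · have hne : permOrbit g a ≠ permOrbit g b := fun h =>
          hab (orbit_refines (comp L) g (inv_sw _ L (comp_edge L)) a b h)
        have hs := same_cycle g S hS hgS a b ha hne
        rw [mg_self _ _ _ hs] at hR
        have h3 := ncard_refine S hS _ _ (mg_min (permOrbit g) (permOrbit g') a b hR hs)
        have h4 := mg_card (permOrbit g) a b S hS ha hb hne
        have h5 := mg_card (comp L) a b S hS ha hb hab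
        omega
    · have hb : b ∉ S := fun h => ha (hq.2 h)
      have hlen : (((a, b) :: L).filter fun p => p.1 ∈ S).length
          = (L.filter fun p => p.1 ∈ S).length := by simp [ha]
      rw [hlen]
      have e1 : mg (comp L) a b '' S = comp L '' S := by
        refine Set.image_congr fun x hx => ?_
        unfold mg
        rw [if_neg]
        intro h
        exact hb ((comp_mem S L H' b).1 (h ▸ (comp_mem S L H' x).2 hx))
      have e2 : (permOrbit g' '' S).ncard ≤ (permOrbit g '' S).ncard := by
        set h : ℤ → Set ℤ := fun x => if x ∈ S then permOrbit g' x else ∅ with hh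
        have : permOrbit g' '' S = h '' S := Set.image_congr fun x hx => by simp [hh, hx]
        rw [this]
        refine ncard_refine S hS _ _ (orbit_refines h g ?_)
        intro x
        simp only [hh, hgS]
        by_cases hx : x ∈ S
        · rw [if_pos hx, if_pos hx, ← orbit_apply g' x, hg', Equiv.Perm.mul_apply,
            Equiv.swap_apply_of_ne_of_ne]
          · rintro rfl; exact ha ((hgS x).2 hx)
          · rintro rfl; exact hb ((hgS x).2 hx)
        · rw [if_neg hx, if_neg hx]
      rw [e1]
      omega

/-! ### generators -/

/-- edges of a generator -/
noncomputable def edges (p : ℤ × ℤ) : List (ℤ × ℤ) :=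
  if p.2 = -p.1 then [p] else [p, (-p.1, -p.2)]

lemma gen_edges (n : ℕ) (g) (hg : g ∈ genB n) :
    ∃ p : ℤ × ℤ, p.1 ∈ signedSet n ∧ p.2 ∈ signedSet n ∧ sw (edges p) = g := by
  rcases hg with ⟨i, j, h1, h2, h3, h4, h5, rfl⟩ | ⟨i, j, h1, h2, h3, h4, h5, rfl⟩ | ⟨i, h1, h2, rfl⟩
  · refine ⟨(i, j), ⟨by dsimp only; omega, abs_le.2 (by dsimp only; omega)⟩, ⟨by dsimp only; omega, abs_le.2 (by dsimp only; omega)⟩, ?_⟩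
    rw [edges, if_neg (by dsimp only; omega)]
    simp [sw]
  · refine ⟨(i, -j), ⟨by dsimp only; omega, abs_le.2 (by dsimp only; omega)⟩, ⟨by dsimp only; omega, abs_le.2 (by dsimp only; omega)⟩, ?_⟩
    rw [edges, if_neg (by dsimp only; omega)]
    simp [sw]
  · refine ⟨(i, -i), ⟨by dsimp only; omega, abs_le.2 (by dsimp only; omega)⟩, ⟨by dsimp only; omega, abs_le.2 (by dsimp only; omega)⟩, ?_⟩
    rw [edges, if_pos rfl]
    simp [sw]

lemma list_edges (n : ℕ) (l : List (Equiv.Perm ℤ)) (hl : ∀ g ∈ l, g ∈ genB n) :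
    ∃ P : List (ℤ × ℤ), P.length = l.length ∧
      (∀ p ∈ P, p.1 ∈ signedSet n ∧ p.2 ∈ signedSet n) ∧ sw (P.flatMap edges) = l.prod := by
  induction l with
  | nil => exact ⟨[], by simp [sw]⟩
  | cons g l ih =>
    obtain ⟨P, h1, h2, h3⟩ := ih fun g hg => hl g (by simp [hg])
    obtain ⟨p, h4, h5, h6⟩ := gen_edges n g (hl g (by simp))
    refine ⟨p :: P, by simp [h1], ?_, ?_⟩
    · intro q hq
      rcases List.mem_cons.1 hq with rfl | hq
      exacts [⟨h4, h5⟩, h2 q hq]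
    · rw [List.flatMap_cons, sw_append, h3, h6, List.prod_cons]

lemma neg_signed (n : ℕ) (x : ℤ) : -x ∈ signedSet n ↔ x ∈ signedSet n := by
  simp [signedSet]

lemma genB_inB (n : ℕ) (g) (hg : g ∈ genB n) : inB n g := by
  rcases hg with ⟨i, j, h1, h2, h3, h4, h5, rfl⟩ | ⟨i, j, h1, h2, h3, h4, h5, rfl⟩ | ⟨i, h1, h2, rfl⟩
  all_goals
    constructor
    · intro x
      simp only [Equiv.Perm.mul_apply, Equiv.swap_apply_def]
      split_ifs <;> omega
    · intro x hx
      have hx : x = 0 ∨ (n : ℤ) < |x| := by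
        by_contra! h; exact hx h
      rw [lt_abs] at hx
      simp only [Equiv.Perm.mul_apply, Equiv.swap_apply_def]
      split_ifs <;> omega

lemma genB_mono (n : ℕ) : genB n ⊆ genB (n+1) := by
  rintro g (⟨i, j, h1, h2, h3, h4, h5, rfl⟩ | ⟨i, j, h1, h2, h3, h4, h5, rfl⟩ | ⟨i, h1, h2, rfl⟩)
  · exact Or.inl ⟨i, j, h1, by push_cast; omega, h3, by push_cast; omega, h5, rfl⟩
  · exact Or.inr (Or.inl ⟨i, j, h1, by push_cast; omega, h3, by push_cast; omega, h5, rfl⟩)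
  · exact Or.inr (Or.inr ⟨i, h1, by push_cast; omega, rfl⟩)

lemma swap_sq (a b c d : ℤ) (h1 : a ≠ c) (h2 : a ≠ d) (h3 : b ≠ c) (h4 : b ≠ d) :
    (Equiv.swap a b * Equiv.swap c d) * (Equiv.swap a b * Equiv.swap c d) = 1 := by
  have h : Equiv.swap c d * Equiv.swap a b = Equiv.swap a b * Equiv.swap c d := by
    rw [Equiv.mul_swap_eq_swap_mul, Equiv.swap_apply_of_ne_of_ne h1 h2,
      Equiv.swap_apply_of_ne_of_ne h3 h4]
  rw [mul_assoc, ← mul_assoc (Equiv.swap c d), h, mul_assoc, Equiv.swap_mul_self, mul_one,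
    Equiv.swap_mul_self]

lemma genB_inv (n : ℕ) (g) (hg : g ∈ genB n) : g * g = 1 := by
  rcases hg with ⟨i, j, h1, h2, h3, h4, h5, rfl⟩ | ⟨i, j, h1, h2, h3, h4, h5, rfl⟩ | ⟨i, h1, h2, rfl⟩
  · exact swap_sq _ _ _ _ (by omega) (by omega) (by omega) (by omega)
  · exact swap_sq _ _ _ _ (by omega) (by omega) (by omega) (by omega)
  · exact Equiv.swap_mul_self _ _

lemma inB_mul {n : ℕ} {g h} (hg : inB n g) (hh : inB n h) : inB n (g * h) := by
  refine ⟨fun x => ?_, fun x hx => ?_⟩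
  · simp [hg.1, hh.1]
  · simp [hg.2 x hx, hh.2 x hx]

lemma inB_inv {n : ℕ} {g} (hg : inB n g) : inB n g⁻¹ := by
  refine ⟨fun x => ?_, fun x hx => ?_⟩
  · rw [Equiv.Perm.inv_eq_iff_eq, hg.1]; simp
  · rw [Equiv.Perm.inv_eq_iff_eq, hg.2 x hx]

lemma inB_down {n : ℕ} {g} (hg : inB (n+1) g) (h : g (n+1) = n+1) : inB n g := by
  refine ⟨hg.1, fun x hx => ?_⟩
  by_cases h1 : x ∈ signedSet (n+1)
  · have : x = n+1 ∨ x = -(n+1) := by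
      have h2 := abs_le.1 h1.2
      have h0 := h1.1
      have h3 : (n : ℤ) < |x| := by
        by_contra! h; exact hx ⟨h0, h⟩
      rw [lt_abs] at h3
      push_cast at h2
      omega
    rcases this with rfl | rfl
    · exact h
    · rw [hg.1, h]
  · exact hg.2 x h1

lemma exists_list (n : ℕ) (τ) (h : inB n τ) :
    ∃ l : List (Equiv.Perm ℤ), l.length ≤ n ∧ (∀ g ∈ l, g ∈ genB n) ∧ l.prod = τ := by
  induction n generalizing τ with
  | zero =>
    refine ⟨[], by simp, by simp, ?_⟩
    ext x
    rw [h.2 x]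
    · simp
    · rintro ⟨h1, h2⟩
      exact h1 (abs_nonpos_iff.1 (by simpa using h2))
  | succ n ih =>
    by_cases hf : τ (n+1) = n+1
    · obtain ⟨l, h1, h2, h3⟩ := ih τ (inB_down h hf)
      exact ⟨l, by omega, fun g hg => genB_mono n (h2 g hg), h3⟩
    · have hmem : τ (n+1) ∈ signedSet (n+1) := by
        by_contra hc
        have := h.2 _ hc
        exact hf (τ.injective this)
      obtain ⟨h0, hle⟩ := hmem
      rw [abs_le] at hle
      push_cast at hle
      obtain ⟨r, hr, hr2⟩ : ∃ r ∈ genB (n+1), r (τ (n+1)) = n+1 := by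
        set j := τ (n+1) with hj
        by_cases hj1 : j = -(n+1)
        · refine ⟨Equiv.swap ((n:ℤ)+1) (-(n+1)), Or.inr (Or.inr ⟨n+1, by omega, by push_cast; omega, rfl⟩), ?_⟩
          rw [hj1, Equiv.swap_apply_right]
        · rcases lt_or_gt_of_ne h0 with hneg | hpos
          · refine ⟨_, Or.inr (Or.inl ⟨n+1, -j, by omega, by push_cast; omega, by omega, by push_cast; omega, by omega, rfl⟩), ?_⟩
            simp only [Equiv.Perm.mul_apply, Equiv.swap_apply_def]
            split_ifs <;> omega
          · refine ⟨_, Or.inl ⟨n+1, j, by omega, by push_cast; omega, by omega, by push_cast; omega, by omega, rfl⟩, ?_⟩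
            simp only [Equiv.Perm.mul_apply, Equiv.swap_apply_def]
            split_ifs <;> omega
      obtain ⟨l, h1, h2, h3⟩ := ih (r * τ) (inB_down (inB_mul (genB_inB _ r hr) h) hr2)
      refine ⟨r :: l, by simp; omega, ?_, ?_⟩
      · intro g hg
        rcases List.mem_cons.1 hg with rfl | hg
        exacts [hr, genB_mono n (h2 g hg)]
      · rw [List.prod_cons, h3, ← mul_assoc, genB_inv _ r hr, one_mul]

lemma lenB_spec (n : ℕ) (τ) (h : inB n τ) : lenB n τ ≤ n ∧
    ∃ l : List (Equiv.Perm ℤ), l.length = lenB n τ ∧ (∀ g ∈ l, g ∈ genB n) ∧ l.prod = τ := by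
  obtain ⟨l, h1, h2, h3⟩ := exists_list n τ h
  have hm : l.length ∈ {k : ℕ | ∃ l : List (Equiv.Perm ℤ),
    l.length = k ∧ (∀ g ∈ l, g ∈ genB n) ∧ l.prod = τ} := ⟨l, rfl, h2, h3⟩
  exact ⟨(Nat.sInf_le hm).trans h1, Nat.sInf_mem ⟨_, hm⟩⟩

/-! ### linear algebra -/

/-- signed basis vector -/
noncomputable def ev (x : ℤ) : ℤ →₀ ℚ := ((SignType.sign x : ℤ) : ℚ) • Finsupp.single |x| 1

lemma ev_neg (x : ℤ) : ev (-x) = - ev x := by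
  simp [ev, Left.sign_neg]

lemma ev_pos (x : ℤ) (h : 0 < x) : ev x = Finsupp.single x 1 := by
  simp [ev, sign_pos h, abs_of_pos h]

lemma card_half (S : Finset ℤ) (h0 : (0:ℤ) ∉ S) (hneg : ∀ x, -x ∈ S ↔ x ∈ S) :
    S.card = 2 * (S.filter (0 < ·)).card := by
  have h1 : S = (S.filter (0 < ·)) ∪ (S.filter (0 < ·)).image (fun x => -x) := by
    ext x
    simp only [Finset.mem_union, Finset.mem_filter, Finset.mem_image]
    constructor
    · intro hx
      have : x ≠ 0 := fun h => h0 (h ▸ hx)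
      rcases lt_or_gt_of_ne this with h | h
      · exact Or.inr ⟨-x, ⟨(hneg x).2 hx, by omega⟩, by simp⟩
      · exact Or.inl ⟨hx, h⟩
    · rintro (h | ⟨y, hy, rfl⟩)
      exacts [h.1, (hneg y).2 hy.1]
  conv_lhs => rw [h1]
  rw [Finset.card_union_of_disjoint, Finset.card_image_of_injective _ neg_injective]
  · omega
  · rw [Finset.disjoint_left]
    simp only [Finset.mem_filter, Finset.mem_image]
    rintro x ⟨_, hx⟩ ⟨y, ⟨_, hy⟩, rfl⟩
    omega

lemma lower (S : Finset ℤ) (h0 : (0:ℤ) ∉ S) (hneg : ∀ x, -x ∈ S ↔ x ∈ S)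
    (P : List (ℤ × ℤ)) (H : ∀ p ∈ P.flatMap edges, (p.1 ∈ S ↔ p.2 ∈ S))
    (hinv : ∀ x ∈ S, -x ∈ permOrbit (sw (P.flatMap edges)) x) :
    S.card ≤ 2 * (P.filter fun p => p.1 ∈ S).length := by
  set T : Finset (ℤ →₀ ℚ) := ((P.filter fun p => p.1 ∈ S).map fun p => ev p.1 - ev p.2).toFinset with hT
  set W : Submodule ℚ (ℤ →₀ ℚ) := Submodule.span ℚ (T : Set (ℤ →₀ ℚ)) with hW
  have hTc : T.card ≤ (P.filter fun p => p.1 ∈ S).length := by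
    refine (List.toFinset_card_le _).trans ?_
    simp
  have hbase : ∀ p ∈ P, p.1 ∈ S → ev p.1 - ev p.2 ∈ W := by
    intro p hp hpS
    apply Submodule.subset_span
    simp only [hT, List.coe_toFinset, Set.mem_ofPred_eq, List.mem_map, List.mem_filter]
    exact ⟨p, ⟨hp, by simpa using hpS⟩, rfl⟩
  have hedge : ∀ p ∈ P.flatMap edges, p.1 ∈ S → ev p.1 - ev p.2 ∈ W := by
    intro p hp hpS
    obtain ⟨q, hq, hpq⟩ := List.mem_flatMap.1 hp
    have : p = q ∨ p = (-q.1, -q.2) := by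
      unfold edges at hpq
      split_ifs at hpq <;> simp at hpq <;> tauto
    rcases this with rfl | rfl
    · exact hbase p hq hpS
    · have := W.neg_mem (hbase q hq ((hneg _).1 hpS))
      simp only [ev_neg]
      convert this using 1
      abel
  set h : ℤ → ((ℤ →₀ ℚ) ⧸ W) := fun x => if x ∈ S then W.mkQ (ev x) else 0 with hh
  have hh1 : ∀ p ∈ P.flatMap edges, h p.1 = h p.2 := by
    intro p hp
    by_cases hpS : p.1 ∈ S
    · simp only [hh, if_pos hpS, if_pos ((H p hp).1 hpS)]
      rw [← sub_eq_zero, ← map_sub]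
      rw [Submodule.mkQ_apply, Submodule.Quotient.mk_eq_zero]
      exact hedge p hp hpS
    · simp only [hh, if_neg hpS, if_neg (fun h => hpS ((H p hp).2 h))]
  have hmem : ∀ x ∈ S, ev x ∈ W := by
    intro x hx
    have := inv_orbit h _ (inv_sw h _ hh1) (hinv x hx)
    simp only [hh, if_pos hx, if_pos ((hneg x).2 hx), ev_neg] at this
    rw [← sub_eq_zero, ← map_sub, Submodule.mkQ_apply, Submodule.Quotient.mk_eq_zero] at this
    have h2 : ev x = (-1/2 : ℚ) • (-ev x - ev x) := by
      rw [smul_sub, smul_neg, ← neg_smul, ← sub_smul]; norm_num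
    rw [h2]
    exact W.smul_mem _ this
  rw [card_half S h0 hneg]
  have hli : LinearIndependent ℚ (fun x : (S.filter (0 < ·)) => (⟨ev x, hmem x (Finset.mem_filter.1 x.2).1⟩ : W)) := by
    apply LinearIndependent.of_comp W.subtype
    have : (W.subtype ∘ fun x : (S.filter (0 < ·)) => (⟨ev x, hmem x (Finset.mem_filter.1 x.2).1⟩ : W))
        = (fun x : ℤ => Finsupp.single x (1:ℚ)) ∘ (fun x : (S.filter (0 < ·)) => (x:ℤ)) := by
      funext x
      simp [ev_pos x (Finset.mem_filter.1 x.2).2]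
    rw [this]
    exact (Finsupp.linearIndependent_single_one ℚ ℤ).comp _ Subtype.val_injective
  have : Module.Finite ℚ W := Module.Finite.span_finset ℚ T
  have h1 := hli.fintype_card_le_finrank
  have h2 : Module.finrank ℚ W ≤ T.card := finrank_span_finset_le_card T
  rw [Fintype.card_coe] at h1
  omega

lemma edges_filter (S : Set ℤ) (hneg : ∀ x, -x ∈ S ↔ x ∈ S) (P : List (ℤ × ℤ)) :
    ((P.flatMap edges).filter fun p => p.1 ∈ S).length ≤
      2 * (P.filter fun p => p.1 ∈ S).length := by
  induction P with
  | nil => simp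
  | cons p P ih =>
    rw [List.flatMap_cons, List.filter_append, List.length_append]
    have : ((edges p).filter fun p => p.1 ∈ S).length ≤ if p.1 ∈ S then 2 else 0 := by
      unfold edges
      split_ifs with h1 h2 h2 <;> simp [h2, hneg]
    by_cases h : p.1 ∈ S
    · simp only [h, if_true] at this
      simp [h]; omega
    · simp only [h, if_false] at this
      have h' : ((p :: P).filter fun p => p.1 ∈ S).length = (P.filter fun p => p.1 ∈ S).length := by
        simp [h]
      rw [h']; omega

lemma signed_finite (n : ℕ) : (signedSet n).Finite := by
  apply (Set.finite_Icc (-(n:ℤ)) n).subset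
  intro x hx
  exact abs_le.1 hx.2

lemma signed_card (n : ℕ) : (signedSet n).ncard = 2 * n := by
  rw [Set.ncard_eq_toFinset_card _ (signed_finite n), card_half]
  · have : (signed_finite n).toFinset.filter (0 < ·) = Finset.Icc 1 (n:ℤ) := by
      ext x
      simp only [Finset.mem_filter, Set.Finite.mem_toFinset, Finset.mem_Icc, signedSet,
        Set.mem_ofPred_eq, abs_le]
      omega
    rw [this]; simp
  · simp [signedSet]
  · intro x; simp [neg_signed]

end NCBaux

/-- Let `γ ∈ B_n` have all orbits inversion-invariant and let `τ ∈ B_n` with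
`τ ≤ γ`. Then for every orbit `Y` of the subgroup generated by `{τ, γ}`, the restriction
`γ_j` of `γ` to `Y` has all of its orbits inversion-invariant, and has at most 2 orbits. -/
theorem ncb_multiannular_genus (n : ℕ) (γ τ : Equiv.Perm ℤ)
    (hγ : inB n γ) (hγinv : ∀ A ∈ orbitsOn n γ, negSet A = A)
    (hτ : inB n τ) (hle : leB n τ γ) :
    ∀ Y ∈ jointOrbitsOn n τ γ,
      (∀ A ∈ orbitsOn n γ, A ⊆ Y → negSet A = A) ∧
      {A | A ∈ orbitsOn n γ ∧ A ⊆ Y}.ncard ≤ 2 := by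
  classical
  intro Y hY
  refine ⟨fun A hA _ => hγinv A hA, ?_⟩
  obtain ⟨x0, hx0, rfl⟩ := hY
  have hσ : inB n (τ⁻¹ * γ) := NCBaux.inB_mul (NCBaux.inB_inv hτ) hγ
  obtain ⟨-, l1, a1, b1, c1⟩ := NCBaux.lenB_spec n τ hτ
  obtain ⟨-, l2, a2, b2, c2⟩ := NCBaux.lenB_spec n _ hσ
  have hlen := (NCBaux.lenB_spec n γ hγ).1
  rw [hle] at hlen
  obtain ⟨P1, d1, e1, f1⟩ := NCBaux.list_edges n l1 b1
  obtain ⟨P2, d2, e2, f2⟩ := NCBaux.list_edges n l2 b2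
  obtain ⟨P, hP⟩ : ∃ P, P = P1 ++ P2 := ⟨_, rfl⟩
  have hPlen : P.length ≤ n := by rw [hP, List.length_append]; omega
  have hPs : ∀ p ∈ P, p.1 ∈ signedSet n ∧ p.2 ∈ signedSet n := by
    intro p hp
    rw [hP, List.mem_append] at hp
    exact hp.elim (e1 p) (e2 p)
  have hLeq : P.flatMap NCBaux.edges = P1.flatMap NCBaux.edges ++ P2.flatMap NCBaux.edges := by
    rw [hP, List.flatMap_append]
  have hLγ : NCBaux.sw (P.flatMap NCBaux.edges) = γ := by
    rw [hLeq, NCBaux.sw_append, f1, f2, c1, c2]; simp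
  have hLs : ∀ p ∈ P.flatMap NCBaux.edges, p.1 ∈ signedSet n ∧ p.2 ∈ signedSet n := by
    intro p hp
    obtain ⟨q, hq, hpq⟩ := List.mem_flatMap.1 hp
    have : p = q ∨ p = (-q.1, -q.2) := by
      unfold NCBaux.edges at hpq
      split_ifs at hpq <;> simp at hpq <;> tauto
    rcases this with rfl | rfl
    · exact hPs p hq
    · simpa [NCBaux.neg_signed] using hPs q hq
  obtain ⟨L, hL⟩ : ∃ L, L = P.flatMap NCBaux.edges := ⟨_, rfl⟩
  obtain ⟨c, hc⟩ : ∃ c, c = NCBaux.comp L := ⟨_, rfl⟩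
  have hce : ∀ p ∈ L, c p.1 = c p.2 := hc ▸ NCBaux.comp_edge L
  have hcτ : ∀ x, c (τ x) = c x := by
    intro x
    rw [← c1, ← f1]
    apply NCBaux.inv_sw
    intro p hp
    apply hce
    rw [hL, hLeq]
    exact List.mem_append_left _ hp
  have hcγ : ∀ x, c (γ x) = c x := by
    intro x
    rw [← hLγ, ← hL]
    exact NCBaux.inv_sw c L hce x
  obtain ⟨S, hS⟩ : ∃ S : Set ℤ, S = {x | x ∈ signedSet n ∧ c x = c x0} := ⟨_, rfl⟩
  have hmS : ∀ x, x ∈ S ↔ x ∈ signedSet n ∧ c x = c x0 := by intro x; rw [hS]; rfl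
  have hSf : S.Finite := (NCBaux.signed_finite n).subset fun x hx => ((hmS x).1 hx).1
  have hself : ∀ x ∈ signedSet n, -x ∈ permOrbit γ x := by
    intro x hx
    have h1 := hγinv _ ⟨x, hx, rfl⟩
    have h2 := NCBaux.self_mem γ x
    rw [← h1] at h2
    exact h2
  have hnegc : ∀ x ∈ signedSet n, c (-x) = c x := fun x hx =>
    NCBaux.inv_orbit c γ hcγ (hself x hx)
  have hSneg : ∀ x, -x ∈ S ↔ x ∈ S := by
    intro x
    rw [hmS, hmS, NCBaux.neg_signed]
    constructor
    · rintro ⟨h1, h2⟩; exact ⟨h1, by rw [← hnegc x h1, h2]⟩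
    · rintro ⟨h1, h2⟩; exact ⟨h1, by rw [hnegc x h1, h2]⟩
  have hScl : ∀ p ∈ L, (p.1 ∈ S ↔ p.2 ∈ S) := by
    intro p hp
    have := hLs p (hL ▸ hp)
    rw [hmS, hmS, hce p hp]
    tauto
  have hur := NCBaux.hurwitz S hSf L hScl
  have hm1 : (NCBaux.comp L '' S).ncard ≤ 1 := by
    rw [← hc]
    have : c '' S ⊆ {c x0} := by
      rintro _ ⟨x, hx, rfl⟩
      exact ((hmS x).1 hx).2
    simpa using Set.ncard_le_ncard this
  have hef := NCBaux.edges_filter S hSneg P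
  rw [← hL] at hef
  -- complement
  obtain ⟨F, hF⟩ : ∃ F : Finset ℤ, F = (NCBaux.signed_finite n).toFinset.filter (· ∉ S) := ⟨_, rfl⟩
  have hmF : ∀ x, x ∈ F ↔ x ∈ signedSet n ∧ x ∉ S := by intro x; rw [hF]; simp
  have hlow := NCBaux.lower F (by rw [hmF]; simp [signedSet])
    (by intro x; rw [hmF, hmF, NCBaux.neg_signed, hSneg]) P
    (by
      intro p hp
      have h1 := hLs p hp
      have h2 := hScl p (hL ▸ hp)
      rw [hmF, hmF]; tauto)
    (by
      intro x hx
      rw [hLγ]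
      exact hself x ((hmF x).1 hx).1)
  have hcard : S.ncard + F.card = 2 * n := by
    rw [← NCBaux.signed_card n, ← Set.ncard_coe_finset F, ← Set.ncard_union_eq _ hSf F.finite_toSet]
    · congr 1
      ext x
      simp only [Set.mem_union, Finset.mem_coe, hmF]
      have := hmS x
      tauto
    · rw [Set.disjoint_left]
      intro x hx hx'
      exact ((hmF x).1 hx').2 hx
  have hsplit : (P.filter fun p => p.1 ∈ S).length + (P.filter fun p => p.1 ∈ F).length = P.length := by
    clear hP hLeq hLγ hLs hL hef hlow hPlen
    induction P with
    | nil => simp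
    | cons p P ih =>
      have ih := ih (fun q hq => hPs q (by simp [hq]))
      have h1 := (hPs p (by simp)).1
      have h2 := hmF p.1
      by_cases h : p.1 ∈ S
      · have h3 : p.1 ∉ F := by tauto
        simp [h, h3] at ih ⊢; omega
      · have h3 : p.1 ∈ F := by tauto
        simp [h, h3] at ih ⊢; omega
  have hfin : {A | A ∈ orbitsOn n γ ∧ A ⊆ jointOrbit τ γ x0}.ncard ≤ (permOrbit γ '' S).ncard := by
    apply Set.ncard_le_ncard _ (hSf.image _)
    rintro A ⟨⟨x, hx, rfl⟩, hA⟩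
    refine ⟨x, (hmS x).2 ⟨hx, ?_⟩, rfl⟩
    obtain ⟨g, hg, hgx⟩ := hA (NCBaux.self_mem γ x)
    rw [← hgx]
    refine NCBaux.inv_closure c {τ, γ} ?_ g hg x0
    rintro g (rfl | rfl)
    exacts [hcτ, hcγ]
  have hsw : NCBaux.sw L = γ := by rw [hL, hLγ]
  rw [hsw] at hur
  omega
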